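/- arXiv:1008.2716 — 3 statements merged into one kernel-verified Lean document; each statement's English description precedes it below -/
import Mathlib

section
/- Let C be a Weyl candidate on n-dimensional Minkowski vector space with superenergy tensor 𝒯, and let ℓ be a null vector. If 𝒯_{αβλμ}ℓ^αℓ^λ = 0 for all β,μ, then 𝒯_{αβλμ}ℓ^αℓ^β = 0 for all λ,μ. -/
open Finset

noncomputable section

/-- Sign of the `i`-th diagonal entry of the Minkowski metric diag(-1,1,...,1). -/
def sgn {n : ℕ} (i : Fin n) : ℝ := if (i : ℕ) = 0 then -1 else 1

/-- The Minkowski metric components η_{ij} (= η^{ij}). -/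
def eta {n : ℕ} (i j : Fin n) : ℝ := if i = j then sgn i else 0

/-- Minkowski square η(v,v) of a vector. -/
def mSq {n : ℕ} (v : Fin n → ℝ) : ℝ := ∑ i, sgn i * v i * v i

/-- Lowered components v_i = η_{ij} v^j. -/
def lo {n : ℕ} (v : Fin n → ℝ) (i : Fin n) : ℝ := sgn i * v i

/-- A Weyl candidate: the index symmetries of the Weyl tensor plus tracelessness. -/
def IsWeyl {n : ℕ} (C : Fin n → Fin n → Fin n → Fin n → ℝ) : Prop :=
  (∀ a b l m, C b a l m = - C a b l m) ∧
  (∀ a b l m, C a b m l = - C a b l m) ∧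
  (∀ a b l m, C a b l m = C l m a b) ∧
  (∀ a b l m, C a b l m + C a l m b + C a m b l = 0) ∧
  (∀ b m, ∑ a, sgn a * C a b a m = 0)

/-- The superenergy (generalized Bel–Robinson) tensor of a Weyl candidate. -/
def SE {n : ℕ} (C : Fin n → Fin n → Fin n → Fin n → ℝ) (a b l m : Fin n) : ℝ :=
  (∑ r, ∑ s, sgn r * sgn s * (C a r l s * C b r m s + C a r m s * C b r l s))
  - (1/2) * eta a b * (∑ r, ∑ t, ∑ s, sgn r * sgn t * sgn s * C r t l s * C r t m s)
  - (1/2) * eta l m * (∑ r, ∑ s, ∑ t, sgn r * sgn s * sgn t * C a r s t * C b r s t)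
  + (1/8) * eta a b * eta l m *
      (∑ r, ∑ t, ∑ s, ∑ v, sgn r * sgn t * sgn s * sgn v * C r t s v * C r t s v)

/-- Evaluation of a 2-index array, viewed as a bilinear form, on a pair of vectors. -/
def form {n : ℕ} (F : Fin n → Fin n → ℝ) (u v : Fin n → ℝ) : ℝ :=
  ∑ a, ∑ b, u a * v b * F a b

/-- Evaluation of a 4-index array, viewed as a multilinear form, on four vectors. -/
def quad {n : ℕ} (C : Fin n → Fin n → Fin n → Fin n → ℝ) (u v w z : Fin n → ℝ) : ℝ :=
  form (fun c d => form (fun a b => C a b c d) u v) w z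

/-- The polarized superenergy tensor of a pair of 2-forms. -/
def superenergyTwo {n : ℕ} (F G : Fin n → Fin n → ℝ) (a b : Fin n) : ℝ :=
  (1/2) * (∑ r, sgn r * (F a r * G b r + G a r * F b r))
  - (1/4) * eta a b * (∑ r, ∑ t, sgn r * sgn t * F r t * G r t)

/-- A null vector `ℓ`, a second vector `k` with `η(ℓ, k) = -1`, and a family `e` completing them
to a decomposition of the inverse metric. -/
structure NullFrame {n : ℕ} (ℓ k : Fin n → ℝ) (e : Fin n → Fin n → ℝ) : Prop where
  decomp : ∀ a b, eta a b = -(ℓ a * k b) - k a * ℓ b + ∑ i, e i a * e i b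
  null : ∑ a, sgn a * ℓ a * ℓ a = 0
  cross : ∑ a, sgn a * ℓ a * k a = -1

theorem sgn_mul_self {n : ℕ} (i : Fin n) : sgn i * sgn i = 1 := by
  unfold sgn; split_ifs <;> norm_num

/-- Every nonzero null vector belongs to a null frame. -/
theorem exists_nullFrame {n : ℕ} {ℓ : Fin n → ℝ} (hℓ0 : ℓ ≠ 0) (hnull : mSq ℓ = 0) :
    ∃ k e, NullFrame ℓ k e := by
  obtain ⟨j, hj⟩ := Function.ne_iff.mp hℓ0
  set S : ℝ := ∑ i, ℓ i * ℓ i with hS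
  have hSpos : 0 < S :=
    sum_pos' (fun i _ => mul_self_nonneg (ℓ i)) ⟨j, mem_univ j, mul_self_pos.mpr hj⟩
  have hS0 : S ≠ 0 := hSpos.ne'
  have htime : ∀ a : Fin n, (a : ℕ) = 0 → 2 * (ℓ a * ℓ a) = S := by
    intro a ha
    have h1 : ∑ i, (1 - sgn i) * (ℓ i * ℓ i) = 2 * (ℓ a * ℓ a) := by
      rw [sum_eq_single a]
      · simp only [sgn, ha, if_true]; ring
      · intro b _ hb
        have : (b : ℕ) ≠ 0 := fun h => hb (Fin.ext (h.trans ha.symm))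
        simp [sgn, this]
      · simp
    have h2 : ∑ i, (1 - sgn i) * (ℓ i * ℓ i) = S - mSq ℓ := by
      rw [hS, mSq, ← sum_sub_distrib]
      exact sum_congr rfl fun i _ => by ring
    rw [← h1, h2, hnull, sub_zero]
  refine ⟨fun i => -(sgn i * ℓ i) / S,
    fun i a => (if i = a then 1 else 0) - (1 + sgn i * sgn a) * (ℓ i * ℓ a) / S, ?_, hnull, ?_⟩
  · intro a b
    have hexp : ∀ i : Fin n,
        ((if i = a then (1 : ℝ) else 0) - (1 + sgn i * sgn a) * (ℓ i * ℓ a) / S) *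
          ((if i = b then 1 else 0) - (1 + sgn i * sgn b) * (ℓ i * ℓ b) / S) =
        (if i = a then (if i = b then (1 : ℝ) else 0) else 0)
          - (if i = a then (1 + sgn i * sgn b) * (ℓ i * ℓ b) / S else 0)
          - (if i = b then (1 + sgn i * sgn a) * (ℓ i * ℓ a) / S else 0)
          + (1 + sgn a * sgn b) * (ℓ a * ℓ b) / S ^ 2 * (ℓ i * ℓ i)
          + (sgn a + sgn b) * (ℓ a * ℓ b) / S ^ 2 * (sgn i * ℓ i * ℓ i) := by
      intro i
      have := sgn_mul_self i
      have hq : (1 + sgn i * sgn a) * (1 + sgn i * sgn b)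
          = 1 + sgn a * sgn b + (sgn a + sgn b) * sgn i := by linear_combination sgn a * sgn b * this
      have hp : (1 + sgn i * sgn a) * (ℓ i * ℓ a) / S * ((1 + sgn i * sgn b) * (ℓ i * ℓ b) / S)
          = (1 + sgn a * sgn b) * (ℓ a * ℓ b) / S ^ 2 * (ℓ i * ℓ i)
          + (sgn a + sgn b) * (ℓ a * ℓ b) / S ^ 2 * (sgn i * ℓ i * ℓ i) := by
        field_simp
        linear_combination ℓ i ^ 2 * ℓ a * ℓ b * hq
      split_ifs <;> linear_combination hp
    simp only [hexp, sum_add_distrib, sum_sub_distrib, ← mul_sum, ← hS, sum_ite_eq', mem_univ,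
      if_true]
    have hnull' : ∑ i, sgn i * ℓ i * ℓ i = 0 := hnull
    rw [hnull']
    by_cases hab : a = b
    · subst hab
      by_cases ha : (a : ℕ) = 0
      · have := htime a ha
        simp only [eta, sgn, ha, if_true]
        field_simp
        linear_combination (2 * S) * this
      · simp only [eta, sgn, ha, if_true, if_false]
        field_simp
        ring
    · have : (1 - sgn a) * (1 - sgn b) = 0 := by
        by_cases ha : (a : ℕ) = 0
        · have hb : (b : ℕ) ≠ 0 := fun hb => hab (Fin.ext (ha.trans hb.symm))
          simp [sgn, hb]
        · simp [sgn, ha]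
      simp only [eta, hab, if_false]
      field_simp
      linear_combination S * ℓ a * ℓ b * this
  · have : ∀ a, sgn a * ℓ a * (-(sgn a * ℓ a) / S) = -(ℓ a * ℓ a) / S := by
      intro a
      linear_combination -(ℓ a * ℓ a) / S * sgn_mul_self a
    simp only [this]
    rw [← sum_div, sum_neg_distrib, ← hS, neg_div, div_self hS0]

section form

variable {n : ℕ}

theorem form_eq_sum_mul (F : Fin n → Fin n → ℝ) (u v : Fin n → ℝ) :
    form F u v = ∑ b, v b * ∑ a, u a * F a b := by
  unfold form
  rw [sum_comm]
  exact sum_congr rfl fun b _ => by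
    rw [mul_sum]; exact sum_congr rfl fun a _ => by ring

theorem form_swap {F : Fin n → Fin n → ℝ} (hF : ∀ a b, F b a = -F a b) (u v : Fin n → ℝ) :
    form F v u = -form F u v := by
  unfold form
  rw [sum_comm, ← sum_neg_distrib]
  refine sum_congr rfl fun a _ => ?_
  rw [← sum_neg_distrib]
  exact sum_congr rfl fun b _ => by rw [hF a b]; ring

theorem form_self {F : Fin n → Fin n → ℝ} (hF : ∀ a b, F b a = -F a b) (u : Fin n → ℝ) :
    form F u u = 0 := by
  linarith [form_swap hF u u]

theorem form_sum {ι : Type*} [Fintype ι] (F : ι → Fin n → Fin n → ℝ) (u v : Fin n → ℝ) :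
    form (fun a b => ∑ i, F i a b) u v = ∑ i, form (F i) u v := by
  simp only [form, mul_sum]
  exact (sum_congr rfl fun a _ => sum_comm).trans sum_comm

theorem form_add (F G : Fin n → Fin n → ℝ) (u v : Fin n → ℝ) :
    form (fun a b => F a b + G a b) u v = form F u v + form G u v := by
  simp only [form, mul_add, sum_add_distrib]

theorem form_sub (F G : Fin n → Fin n → ℝ) (u v : Fin n → ℝ) :
    form (fun a b => F a b - G a b) u v = form F u v - form G u v := by
  simp only [form, mul_sub, sum_sub_distrib]

theorem form_mul_left (c : ℝ) (F : Fin n → Fin n → ℝ) (u v : Fin n → ℝ) :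
    form (fun a b => c * F a b) u v = c * form F u v := by
  simp only [form, mul_sum]
  exact sum_congr rfl fun a _ => sum_congr rfl fun b _ => by ring

theorem form_mul_right (F : Fin n → Fin n → ℝ) (c : ℝ) (u v : Fin n → ℝ) :
    form (fun a b => F a b * c) u v = form F u v * c := by
  simp only [mul_comm _ c, form_mul_left]

theorem form_neg (F : Fin n → Fin n → ℝ) (u v : Fin n → ℝ) :
    form (fun a b => -F a b) u v = -form F u v := by
  simp only [form, mul_neg, sum_neg_distrib]

theorem form_prod (f g u v : Fin n → ℝ) :
    form (fun a b => f a * g b) u v = (∑ a, u a * f a) * ∑ b, v b * g b := by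
  rw [form, sum_mul_sum]
  exact sum_congr rfl fun a _ => sum_congr rfl fun b _ => by ring

theorem form_eta (u v : Fin n → ℝ) : form eta u v = ∑ a, sgn a * u a * v a := by
  simp only [form, eta, mul_ite, mul_zero, sum_ite_eq, mem_univ, if_true]
  exact sum_congr rfl fun a _ => by ring

theorem form_eq_zero {F : Fin n → Fin n → ℝ} (hF : ∀ a b, F a b = 0) (u v : Fin n → ℝ) :
    form F u v = 0 := by
  simp [form, hF]

/-- The two pairs of arguments of a multilinear form may be evaluated in either order. -/
theorem quad_eq (C : Fin n → Fin n → Fin n → Fin n → ℝ) (u v w z : Fin n → ℝ) :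
    quad C u v w z = form (fun a b => form (fun c d => C a b c d) w z) u v := by
  unfold quad
  conv_lhs =>
    enter [1, c, d]
    unfold form
  simp only [form_sum, form_mul_left]
  rfl

/-- The first and third arguments of a multilinear form may be evaluated first. -/
theorem quad_eq_outer (C : Fin n → Fin n → Fin n → Fin n → ℝ) (u v w z : Fin n → ℝ) :
    quad C u v w z = form (fun b m => form (fun a l => C a b l m) u w) v z := by
  simp only [quad, form, mul_sum]
  rw [sum_comm]
  conv_rhs => rw [sum_comm]
  refine sum_congr rfl fun d _ => ?_
  rw [sum_comm]
  conv_rhs => rw [sum_comm]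
  refine sum_congr rfl fun a _ => ?_
  rw [sum_comm]
  exact sum_congr rfl fun b _ => sum_congr rfl fun c _ => by ring

theorem form_superenergyTwo (F G : Fin n → Fin n → ℝ) (u v : Fin n → ℝ) :
    form (superenergyTwo F G) u v =
      (1/2) * (∑ r, sgn r * ((∑ a, u a * F a r) * ∑ b, v b * G b r)
        + ∑ r, sgn r * ((∑ a, u a * G a r) * ∑ b, v b * F b r))
      - (1/4) * (∑ a, sgn a * u a * v a) * ∑ r, ∑ t, sgn r * sgn t * F r t * G r t := by
  unfold superenergyTwo
  simp only [form_sub, form_mul_left, form_mul_right, form_sum, form_add, form_prod, form_eta,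
    mul_add, sum_add_distrib]

end form

namespace NullFrame

variable {n : ℕ} {ℓ k : Fin n → ℝ} {e : Fin n → Fin n → ℝ}

theorem sum_sgn_mul (h : NullFrame ℓ k e) (f g : Fin n → ℝ) :
    ∑ r, sgn r * (f r * g r) =
      -((∑ a, ℓ a * f a) * ∑ a, k a * g a) - (∑ a, k a * f a) * (∑ a, ℓ a * g a)
        + ∑ i, (∑ a, e i a * f a) * ∑ a, e i a * g a := by
  have h1 : ∑ r, sgn r * (f r * g r) = form eta f g := by
    rw [form_eta]; exact sum_congr rfl fun a _ => by ring
  have h2 : (eta : Fin n → Fin n → ℝ) =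
      fun a b => -(ℓ a * k b) - k a * ℓ b + ∑ i, e i a * e i b := by
    funext a b; exact h.decomp a b
  rw [h1, h2]
  simp only [form_add, form_sub, form_neg, form_sum, form_prod]
  simp only [mul_comm]

theorem sum_sgn_mul_sgn (h : NullFrame ℓ k e) {F G : Fin n → Fin n → ℝ}
    (hF : ∀ a b, F b a = -F a b) (hG : ∀ a b, G b a = -G a b) :
    ∑ r, ∑ t, sgn r * sgn t * F r t * G r t =
      -(2 * (form F ℓ k * form G ℓ k))
      - 2 * (∑ i, (form F ℓ (e i) * form G k (e i) + form F k (e i) * form G ℓ (e i)))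
      + ∑ i, ∑ j, form F (e i) (e j) * form G (e i) (e j) := by
  have hinner : ∀ r, ∑ t, sgn r * sgn t * F r t * G r t =
      sgn r * (-((∑ a, ℓ a * F r a) * ∑ a, k a * G r a))
        - sgn r * ((∑ a, k a * F r a) * (∑ a, ℓ a * G r a))
        + ∑ i, sgn r * ((∑ a, e i a * F r a) * ∑ a, e i a * G r a) := by
    intro r
    rw [← mul_sum, ← mul_sub, ← mul_add, ← h.sum_sgn_mul, mul_sum]
    exact sum_congr rfl fun t _ => by ring
  have hform : ∀ (F : Fin n → Fin n → ℝ) (u v : Fin n → ℝ),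
      ∑ a, u a * ∑ b, v b * F a b = form F u v := by
    intro F u v
    simp only [form, mul_sum, mul_assoc]
  simp only [hinner, sum_add_distrib, sum_sub_distrib, mul_neg, sum_neg_distrib]
  rw [sum_comm]
  simp only [h.sum_sgn_mul, hform, form_self hF, form_self hG, form_swap hF ℓ k, form_swap hG ℓ k,
    form_swap hF ℓ (e _), form_swap hG ℓ (e _), form_swap hF k (e _), form_swap hG k (e _),
    sum_add_distrib, sum_sub_distrib, sum_neg_distrib, neg_mul, mul_neg, neg_neg]
  rw [sum_comm (f := fun i j => form F (e j) (e i) * form G (e j) (e i))]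
  ring

end NullFrame

/-- A decomposition of the superenergy of 2-forms at `(u, v)` into weighted squares. -/
def SquareDecomp {n : ℕ} {ι : Type*} [Fintype ι] (u v : Fin n → ℝ) (c : ι → ℝ)
    (p q : ι → Fin n → ℝ) : Prop :=
  ∀ F G : Fin n → Fin n → ℝ, (∀ a b, F b a = -F a b) → (∀ a b, G b a = -G a b) →
    form (superenergyTwo F G) u v = ∑ A, c A * (form F (p A) (q A) * form G (p A) (q A))

section decomposition

variable {n : ℕ} {ℓ k : Fin n → ℝ} {e : Fin n → Fin n → ℝ}

theorem NullFrame.squareDecomp_null (h : NullFrame ℓ k e) :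
    SquareDecomp ℓ ℓ (fun _ => 1) (fun _ => ℓ) e := by
  intro F G hF hG
  rw [form_superenergyTwo, h.null, h.sum_sgn_mul, h.sum_sgn_mul]
  simp only [← form_eq_sum_mul, form_self hF, form_self hG, mul_comm (form G _ _), one_mul]
  ring

theorem NullFrame.squareDecomp_cross (h : NullFrame ℓ k e) :
    SquareDecomp ℓ k (fun A : Option (Fin n × Fin n) => A.elim (1/2) fun _ => 1/4)
      (fun A => A.elim ℓ fun ij => e ij.1) (fun A => A.elim k fun ij => e ij.2) := by
  intro F G hF hG
  rw [form_superenergyTwo, h.cross, h.sum_sgn_mul, h.sum_sgn_mul, h.sum_sgn_mul_sgn hF hG]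
  simp only [← form_eq_sum_mul, form_self hF, form_self hG, form_swap hF ℓ k, form_swap hG ℓ k,
    Fintype.sum_option, Option.elim, Fintype.sum_prod_type, ← mul_sum, sum_add_distrib,
    mul_comm (form G _ _)]
  ring

theorem SE_eq_superenergyTwo (C : Fin n → Fin n → Fin n → Fin n → ℝ) (a b l m : Fin n) :
    SE C a b l m =
      2 * (∑ s, sgn s * superenergyTwo (fun a b => C a b l s) (fun a b => C a b m s) a b)
      - (1/2) * eta l m * (∑ s, ∑ t, sgn s * sgn t *
          superenergyTwo (fun a b => C a b s t) (fun a b => C a b s t) a b) := by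
  have h1 : ∑ s, sgn s * superenergyTwo (fun a b => C a b l s) (fun a b => C a b m s) a b =
      (1/2) * (∑ r, ∑ s, sgn r * sgn s * (C a r l s * C b r m s + C a r m s * C b r l s))
      - (1/4) * eta a b * (∑ r, ∑ t, ∑ s, sgn r * sgn t * sgn s * C r t l s * C r t m s) := by
    simp only [superenergyTwo, mul_sub, mul_sum, sum_sub_distrib]
    congr 1
    · rw [sum_comm]
      exact sum_congr rfl fun r _ => sum_congr rfl fun s _ => by ring
    · rw [sum_comm]
      refine sum_congr rfl fun r _ => ?_
      rw [sum_comm]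
      exact sum_congr rfl fun t _ => sum_congr rfl fun s _ => by ring
  have h2 : ∑ s, ∑ t, sgn s * sgn t *
        superenergyTwo (fun a b => C a b s t) (fun a b => C a b s t) a b =
      (∑ r, ∑ s, ∑ t, sgn r * sgn s * sgn t * C a r s t * C b r s t)
      - (1/4) * eta a b *
        (∑ r, ∑ t, ∑ s, ∑ v, sgn r * sgn t * sgn s * sgn v * C r t s v * C r t s v) := by
    simp only [superenergyTwo, mul_sub, mul_sum, sum_sub_distrib]
    congr 1
    · conv_rhs => rw [sum_comm]
      refine sum_congr rfl fun s _ => ?_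
      conv_rhs => rw [sum_comm]
      exact sum_congr rfl fun t _ => sum_congr rfl fun r _ => by ring
    · have hswap : ∀ f : Fin n → Fin n → Fin n → Fin n → ℝ,
          ∑ r, ∑ t, ∑ s, ∑ v, f r t s v = ∑ s, ∑ v, ∑ r, ∑ t, f r t s v :=
        fun f => (sum_congr rfl fun r _ => sum_comm.trans (sum_congr rfl fun s _ => sum_comm)).trans
          (sum_comm.trans (sum_congr rfl fun s _ => sum_comm))
      rw [hswap]
      exact sum_congr rfl fun s _ => sum_congr rfl fun v _ => sum_congr rfl fun r _ =>
        sum_congr rfl fun t _ => by ring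
  rw [h1, h2, SE]
  ring

theorem form_SE {ι : Type*} [Fintype ι] {C : Fin n → Fin n → Fin n → Fin n → ℝ}
    (hC₁ : ∀ a b l m, C b a l m = - C a b l m) {u v : Fin n → ℝ} {c : ι → ℝ}
    {p q : ι → Fin n → ℝ} (h : SquareDecomp u v c p q) (l m : Fin n) :
    form (fun a b => SE C a b l m) u v =
      ∑ A, 2 * c A * superenergyTwo (fun l s => form (fun a b => C a b l s) (p A) (q A))
        (fun l s => form (fun a b => C a b l s) (p A) (q A)) l m := by
  have hswap : ∀ s t, ∀ a b, C b a s t = - C a b s t := fun s t a b => hC₁ a b s t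
  simp only [SE_eq_superenergyTwo, form_sub, form_mul_left, form_sum]
  simp only [h _ _ (hswap _ _) (hswap _ _), superenergyTwo, mul_sub, mul_sum, sum_sub_distrib]
  congr 1
  · rw [sum_comm]
    exact sum_congr rfl fun A _ => sum_congr rfl fun s _ => by ring
  · rw [sum_congr rfl fun s _ => sum_comm, sum_comm]
    exact sum_congr rfl fun A _ => sum_congr rfl fun s _ => sum_congr rfl fun t _ => by ring

theorem quad_SE {ι κ : Type*} [Fintype ι] [Fintype κ] {C : Fin n → Fin n → Fin n → Fin n → ℝ}
    (hC₁ : ∀ a b l m, C b a l m = - C a b l m) (hC₂ : ∀ a b l m, C a b m l = - C a b l m)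
    {u v w z : Fin n → ℝ} {c : ι → ℝ} {p q : ι → Fin n → ℝ} {c' : κ → ℝ} {p' q' : κ → Fin n → ℝ}
    (h : SquareDecomp u v c p q) (h' : SquareDecomp w z c' p' q') :
    quad (SE C) u v w z = ∑ A, 2 * c A * ∑ B, c' B * (quad C (p A) (q A) (p' B) (q' B)) ^ 2 := by
  have hpair : ∀ p q : Fin n → ℝ, ∀ l m, form (fun a b => C a b m l) p q =
      -form (fun a b => C a b l m) p q := by
    intro p q l m
    rw [← form_neg]
    simp only [hC₂ _ _ l m]
  simp only [quad, form_SE hC₁ h, form_sum, form_mul_left, h' _ _ (hpair _ _) (hpair _ _), sq]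

/-- If the superenergy tensor vanishes in directions where it is a sum of squares with positive
weights, then all the components being squared vanish. -/
theorem quad_eq_zero_of_quad_SE {ι κ : Type*} [Fintype ι] [Fintype κ]
    {C : Fin n → Fin n → Fin n → Fin n → ℝ}
    (hC₁ : ∀ a b l m, C b a l m = - C a b l m) (hC₂ : ∀ a b l m, C a b m l = - C a b l m)
    {u v w z : Fin n → ℝ} {c : ι → ℝ} {p q : ι → Fin n → ℝ} {c' : κ → ℝ} {p' q' : κ → Fin n → ℝ}
    (h : SquareDecomp u v c p q) (h' : SquareDecomp w z c' p' q')
    (hc : ∀ A, 0 < c A) (hc' : ∀ B, 0 < c' B) (h0 : quad (SE C) u v w z = 0) (A : ι) (B : κ) :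
    quad C (p A) (q A) (p' B) (q' B) = 0 := by
  have hterm : ∀ A B, 0 ≤ c' B * (quad C (p A) (q A) (p' B) (q' B)) ^ 2 :=
    fun A B => mul_nonneg (hc' B).le (sq_nonneg _)
  rw [quad_SE hC₁ hC₂ h h', sum_eq_zero_iff_of_nonneg fun A _ =>
    mul_nonneg (mul_nonneg two_pos.le (hc A).le) (sum_nonneg fun B _ => hterm A B)] at h0
  have hA := (mul_eq_zero.mp (h0 A (mem_univ A))).resolve_left (mul_pos two_pos (hc A)).ne'
  rw [sum_eq_zero_iff_of_nonneg fun B _ => hterm A B] at hA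
  exact pow_eq_zero_iff two_ne_zero |>.mp
    ((mul_eq_zero.mp (hA B (mem_univ B))).resolve_left (hc' B).ne')

theorem NullFrame.eq_zero_of_sum_mul (h : NullFrame ℓ k e) {f : Fin n → ℝ}
    (h₁ : ∑ a, ℓ a * f a = 0) (h₂ : ∑ a, k a * f a = 0) (h₃ : ∀ i, ∑ a, e i a * f a = 0)
    (b : Fin n) : f b = 0 := by
  have h0 := h.sum_sgn_mul f (Pi.single b (sgn b))
  simp only [h₁, h₂, h₃, Pi.single_apply, mul_ite, mul_zero, zero_mul, sum_const_zero, sum_ite_eq',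
    mem_univ, if_true, neg_zero, sub_zero, add_zero] at h0
  linear_combination h0 - f b * sgn_mul_self b

/-- A 2-form is determined by its components in a null frame. -/
theorem NullFrame.eq_zero (h : NullFrame ℓ k e) {F : Fin n → Fin n → ℝ}
    (hF : ∀ a b, F b a = -F a b) (h₁ : form F ℓ k = 0) (h₂ : ∀ i, form F ℓ (e i) = 0)
    (h₃ : ∀ i, form F k (e i) = 0) (h₄ : ∀ i j, form F (e i) (e j) = 0) (a b : Fin n) :
    F a b = 0 := by
  have h₅ : ∀ u, form F ℓ u = 0 → form F k u = 0 → (∀ i, form F (e i) u = 0) →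
      ∀ a, ∑ b, u b * F a b = 0 := by
    have hform : ∀ u v : Fin n → ℝ, form F v u = ∑ a, v a * ∑ b, u b * F a b := by
      intro u v
      simp only [form, mul_sum, mul_assoc]
    intro u hu₁ hu₂ hu₃
    simp only [hform] at hu₁ hu₂ hu₃
    exact h.eq_zero_of_sum_mul hu₁ hu₂ hu₃
  have hℓk : form F k ℓ = 0 := by rw [form_swap hF, h₁, neg_zero]
  refine h.eq_zero_of_sum_mul (f := F a) (h₅ ℓ (form_self hF ℓ) hℓk (fun i => ?_) a)
    (h₅ k h₁ (form_self hF k) (fun i => ?_) a)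
    (fun j => h₅ (e j) (h₂ j) (h₃ j) (fun i => h₄ i j) a) b
  · rw [form_swap hF, h₂, neg_zero]
  · rw [form_swap hF, h₃, neg_zero]

end decomposition

section weyl

variable {n : ℕ} {C : Fin n → Fin n → Fin n → Fin n → ℝ} {ℓ k : Fin n → ℝ}
  {e : Fin n → Fin n → ℝ}

theorem IsWeyl.quad_swap_snd (hC : IsWeyl C) (u v w z : Fin n → ℝ) :
    quad C u v z w = -quad C u v w z :=
  form_swap (fun c d => by simp only [hC.2.1 _ _ c d, form_neg]) w z

theorem IsWeyl.quad_pair (hC : IsWeyl C) (u v w z : Fin n → ℝ) :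
    quad C w z u v = quad C u v w z := by
  rw [quad_eq, quad]
  simp only [fun a b c d => hC.2.2.1 a b c d]

theorem quad_eq_sum (C : Fin n → Fin n → Fin n → Fin n → ℝ) (u v w z : Fin n → ℝ) :
    quad C u v w z = ∑ a, ∑ b, ∑ c, ∑ d, u a * v b * w c * z d * C a b c d := by
  simp only [quad_eq, form, mul_sum, mul_assoc]

theorem IsWeyl.quad_cyclic (hC : IsWeyl C) (u v w z : Fin n → ℝ) :
    quad C u v w z + quad C u w z v + quad C u z v w = 0 := by
  have h₁ : quad C u w z v = ∑ a, ∑ b, ∑ c, ∑ d, u a * w c * z d * v b * C a c d b := by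
    rw [quad_eq_sum]
    exact sum_congr rfl fun a _ => (sum_congr rfl fun c _ => sum_comm).trans sum_comm
  have h₂ : quad C u z v w = ∑ a, ∑ b, ∑ c, ∑ d, u a * z d * v b * w c * C a d b c := by
    rw [quad_eq_sum]
    exact sum_congr rfl fun a _ => sum_comm.trans (sum_congr rfl fun b _ => sum_comm)
  rw [quad_eq_sum, h₁, h₂]
  simp only [← sum_add_distrib]
  refine sum_eq_zero fun a _ => sum_eq_zero fun b _ => sum_eq_zero fun c _ =>
    sum_eq_zero fun d _ => ?_
  linear_combination u a * v b * w c * z d * hC.2.2.2.1 a b c d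

theorem NullFrame.trace (h : NullFrame ℓ k e) (D : Fin n → Fin n → ℝ) :
    -form D ℓ k - form D k ℓ + ∑ i, form D (e i) (e i) = ∑ r, sgn r * D r r := by
  have h1 : ∑ r, sgn r * D r r = ∑ a, ∑ b, eta a b * D a b := by
    simp [eta]
  have h2 : ∑ i, form D (e i) (e i) = ∑ a, ∑ b, (∑ i, e i a * e i b) * D a b := by
    simp only [form, sum_mul]
    rw [sum_comm]
    exact sum_congr rfl fun a _ => sum_comm
  rw [h1, h2]
  simp only [h.decomp, add_mul, sub_mul, neg_mul, sum_add_distrib, sum_sub_distrib,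
    sum_neg_distrib, form]

theorem IsWeyl.quad_trace (hC : IsWeyl C) (h : NullFrame ℓ k e) (v z : Fin n → ℝ) :
    -quad C ℓ v k z - quad C k v ℓ z + ∑ i, quad C (e i) v (e i) z = 0 := by
  simp only [quad_eq_outer, ← form_neg, ← form_sub, ← form_sum, ← form_add]
  refine form_eq_zero (fun b m => ?_) v z
  rw [form_neg, h.trace fun a l => C a b l m]
  exact hC.2.2.2.2 b m

end weyl

/-- for a null ℓ, 𝒯_{αβλμ}ℓ^αℓ^λ = 0 implies 𝒯_{αβλμ}ℓ^αℓ^β = 0. -/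
theorem stmt_12 {n : ℕ} (hn : 2 ≤ n) (C : Fin n → Fin n → Fin n → Fin n → ℝ)
    (hC : IsWeyl C)
    (ℓ : Fin n → ℝ) (hℓ0 : ℓ ≠ 0) (hnull : mSq ℓ = 0)
    (h : ∀ b m : Fin n, ∑ a, ∑ l, SE C a b l m * ℓ a * ℓ l = 0) :
    ∀ l m : Fin n, ∑ a, ∑ b, SE C a b l m * ℓ a * ℓ b = 0 := by
  obtain ⟨k, e, hf⟩ := exists_nullFrame hℓ0 hnull
  have hzero : ∀ v z, quad (SE C) ℓ v ℓ z = 0 := by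
    intro v z
    have h' : ∀ b m, form (fun a l => SE C a b l m) ℓ ℓ = 0 := by
      intro b m
      rw [← h b m]
      exact sum_congr rfl fun a _ => sum_congr rfl fun l _ => by ring
    rw [quad_eq_outer]
    exact form_eq_zero h' v z
  have hd₀ := hf.squareDecomp_null
  have hd₁ := hf.squareDecomp_cross
  have hw₀ : ∀ i : Fin n, (0 : ℝ) < 1 := fun _ => one_pos
  have hw₁ : ∀ A : Option (Fin n × Fin n), (0 : ℝ) < A.elim (1/2) fun _ => 1/4 := by
    rintro (_ | _) <;> norm_num
  have hC₁ := hC.1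
  have hC₂ := hC.2.1
  have hij : ∀ i j, quad C ℓ (e i) ℓ (e j) = 0 :=
    quad_eq_zero_of_quad_SE hC₁ hC₂ hd₀ hd₀ hw₀ hw₀ (hzero ℓ ℓ)
  have hnc := quad_eq_zero_of_quad_SE hC₁ hC₂ hd₀ hd₁ hw₀ hw₁ (hzero ℓ k)
  have hcc := quad_eq_zero_of_quad_SE hC₁ hC₂ hd₁ hd₁ hw₁ hw₁ (hzero k k)
  have hik : ∀ i, quad C ℓ (e i) ℓ k = 0 := fun i => hnc i none
  have hijl : ∀ i j l, quad C ℓ (e i) (e j) (e l) = 0 := fun i j l => hnc i (some (j, l))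
  have hcross : ∀ i j, quad C ℓ k (e i) (e j) = 0 := fun i j => hcc none (some (i, j))
  have hspace : ∀ r i s j, quad C (e r) (e i) (e s) (e j) = 0 :=
    fun r i s j => hcc (some (r, i)) (some (s, j))
  have hmixed : ∀ i j, quad C ℓ (e i) k (e j) = 0 := by
    intro i j
    have h₁ := hC.quad_cyclic ℓ k (e i) (e j)
    have h₂ := hC.quad_trace hf (e i) (e j)
    simp only [hspace, sum_const_zero] at h₂
    rw [hcross, hC.quad_swap_snd ℓ (e i) k (e j)] at h₁
    rw [hC.quad_pair ℓ (e j) k (e i)] at h₂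
    linarith
  have hform : ∀ i c d, form (fun a b => C a b c d) ℓ (e i) = 0 := by
    intro i
    refine hf.eq_zero (F := fun c d => form (fun a b => C a b c d) ℓ (e i))
      (fun c d => ?_) (hik i) (hij i) (hmixed i) (hijl i)
    simp only [hC₂ _ _ c d, form_neg]
  intro l m
  have hSE := form_SE hC₁ hd₀ l m
  simp only [hform, superenergyTwo, mul_zero, add_zero, sum_const_zero, sub_zero] at hSE
  rw [← hSE]
  exact sum_congr rfl fun a _ => sum_congr rfl fun b _ => by ring
end
end

section
/- Let A be an arbitrary 2-index real array on n-dimensional Minkowski vector space with superenergy tensor T, and let ℓ be a null vector. Then T_{αβλμ}ℓ^αℓ^βℓ^λℓ^μ = 0 if and only if A_{μν}ℓ^μℓ^ν = 0. -/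
open Finset

noncomputable section

/-- The superenergy tensor of an arbitrary 2-index array A (no symmetries assumed). -/
def SE2 {n : ℕ} (A : Fin n → Fin n → ℝ) (a b l m : Fin n) : ℝ :=
  A a l * A b m + A b l * A a m
  - eta a b * (∑ r, sgn r * A r l * A r m)
  - eta l m * (∑ r, sgn r * A a r * A b r)
  + (1/2) * eta a b * eta l m * (∑ r, ∑ s, sgn r * sgn s * A r s * A r s)

/-- The metric contracted twice with a vector is the Minkowski square of that vector. -/
theorem sum_eta_mul_mul {n : ℕ} (v : Fin n → ℝ) :
    ∑ a, ∑ b, eta a b * v a * v b = mSq v := by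
  simp [eta, mSq]

theorem sum_four_mul {n : ℕ} (f g : Fin n → Fin n → ℝ) :
    ∑ a, ∑ b, ∑ l, ∑ m, f a b * g l m = (∑ a, ∑ b, f a b) * ∑ l, ∑ m, g l m := by
  simp only [← Finset.mul_sum, ← Finset.sum_mul]

/-- Contracting the superenergy tensor four times with a null vector gives twice the square of
the full contraction of the array. -/
theorem sum_SE2_of_mSq_eq_zero {n : ℕ} (A : Fin n → Fin n → ℝ) (v : Fin n → ℝ)
    (hv : mSq v = 0) :
    ∑ a, ∑ b, ∑ l, ∑ m, SE2 A a b l m * v a * v b * v l * v m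
      = 2 * (∑ a, ∑ b, A a b * v a * v b) ^ 2 := by
  have split : ∀ a b l m, SE2 A a b l m * v a * v b * v l * v m =
      (A a l * v a * v l) * (A b m * v b * v m) + (A b l * v b * v l) * (A a m * v a * v m)
      - (eta a b * v a * v b) * ((∑ r, sgn r * A r l * A r m) * v l * v m)
      - ((∑ r, sgn r * A a r * A b r) * v a * v b) * (eta l m * v l * v m)
      + (eta a b * v a * v b) *
        ((1/2) * (∑ r, ∑ s, sgn r * sgn s * A r s * A r s) * (eta l m * v l * v m)) := by
    intro a b l m
    simp only [SE2]
    ring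
  have straight : ∑ a, ∑ b, ∑ l, ∑ m, (A a l * v a * v l) * (A b m * v b * v m)
      = (∑ a, ∑ b, A a b * v a * v b) ^ 2 := by
    rw [sq, ← sum_four_mul]
    exact Finset.sum_congr rfl fun a _ => Finset.sum_comm
  have crossed : ∑ a, ∑ b, ∑ l, ∑ m, (A b l * v b * v l) * (A a m * v a * v m)
      = (∑ a, ∑ b, A a b * v a * v b) ^ 2 := by
    rw [Finset.sum_comm, straight]
  simp only [split, Finset.sum_add_distrib, Finset.sum_sub_distrib]
  rw [straight, crossed, sum_four_mul, sum_four_mul, sum_four_mul, sum_eta_mul_mul, hv]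
  ring

/-- T_{αβλμ}ℓ^αℓ^βℓ^λℓ^μ = 0 iff A_{μν}ℓ^μℓ^ν = 0, for null ℓ. -/
theorem stmt_13 {n : ℕ} (hn : 2 ≤ n) (A : Fin n → Fin n → ℝ)
    (ℓ : Fin n → ℝ) (hℓ0 : ℓ ≠ 0) (hnull : mSq ℓ = 0) :
    (∑ a, ∑ b, ∑ l, ∑ m, SE2 A a b l m * ℓ a * ℓ b * ℓ l * ℓ m = 0) ↔
      (∑ m, ∑ v, A m v * ℓ m * ℓ v = 0) := by
  rw [sum_SE2_of_mSq_eq_zero A ℓ hnull]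
  simp
end
end

section
/- Let A be an arbitrary 2-index real array on n-dimensional Minkowski vector space with superenergy tensor T, and let ℓ be a null vector. Then T_{αβλμ}ℓ^αℓ^βℓ^λ = 0 for all μ if and only if (ℓ^μA_{μν})ℓ_τ − (ℓ^μA_{μτ})ℓ_ν = 0 for all ν,τ. -/
open Finset

noncomputable section

theorem mSq_lo {n : ℕ} (v : Fin n → ℝ) : mSq (lo v) = mSq v := by
  unfold mSq lo
  refine Finset.sum_congr rfl fun i _ => ?_
  linear_combination (sgn i * v i * v i) * sgn_mul_self i

/-- A null vector whose time component vanishes is zero. -/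
theorem eq_zero_of_mSq_eq_zero {n : ℕ} (x : Fin n → ℝ)
    (h0 : ∀ i : Fin n, (i : ℕ) = 0 → x i = 0) (hx : mSq x = 0) (i : Fin n) : x i = 0 := by
  have hsq : ∀ j : Fin n, sgn j * x j * x j = x j * x j := by
    intro j
    by_cases hj : (j : ℕ) = 0
    · simp [h0 j hj]
    · simp [sgn, hj]
  unfold mSq at hx
  rw [Finset.sum_congr rfl fun j _ => hsq j,
    Finset.sum_eq_zero_iff_of_nonneg fun j _ => mul_self_nonneg (x j)] at hx
  exact mul_self_eq_zero.mp (hx i (Finset.mem_univ i))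

theorem sum_eta_mul {n : ℕ} (v : Fin n → ℝ) (m : Fin n) : ∑ l, eta l m * v l = lo v m := by
  simp [eta, lo]

/-- Orthogonal null vectors are parallel. -/
theorem mul_eq_mul_of_null_of_orthogonal {n : ℕ} (u v : Fin n → ℝ) (hu : mSq u = 0)
    (hv : mSq v = 0) (huv : ∑ i, sgn i * u i * v i = 0) (i j : Fin n) :
    u i * v j = u j * v i := by
  let o : Fin n := ⟨0, i.pos⟩
  have ho : ∀ k : Fin n, (k : ℕ) = 0 → k = o := fun k hk => Fin.ext hk
  by_cases hvo : v o = 0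
  · have h := eq_zero_of_mSq_eq_zero v (fun k hk => by rw [ho k hk, hvo]) hv
    simp [h]
  · have h := eq_zero_of_mSq_eq_zero (fun k => u k * v o - u o * v k)
      (fun k hk => by rw [ho k hk]; ring) (by
        have : mSq (fun k => u k * v o - u o * v k) =
            v o ^ 2 * mSq u - 2 * u o * v o * (∑ k, sgn k * u k * v k) + u o ^ 2 * mSq v := by
          unfold mSq
          simp only [Finset.mul_sum, ← Finset.sum_sub_distrib, ← Finset.sum_add_distrib]
          exact Finset.sum_congr rfl fun k _ => by ring
        rw [this, hu, hv, huv]; ring)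
    apply mul_left_cancel₀ hvo
    linear_combination v j * h i - v i * h j

/-- The contraction of the superenergy tensor with a null vector in three slots. -/
theorem sum_SE2_of_null {n : ℕ} (A : Fin n → Fin n → ℝ) (v w : Fin n → ℝ) (hv : mSq v = 0)
    (hw : ∀ i, w i = ∑ a, v a * A a i) (m : Fin n) :
    ∑ a, ∑ b, ∑ l, SE2 A a b l m * v a * v b * v l =
      2 * (∑ l, w l * v l) * w m - mSq w * lo v m := by
  have hww : ∀ i j, ∑ a, ∑ b, A a i * A b j * v a * v b = w i * w j := by
    intro i j
    rw [hw, hw, Finset.sum_mul_sum]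
    exact Finset.sum_congr rfl fun a _ => Finset.sum_congr rfl fun b _ => by ring
  have hq : ∑ a, ∑ b, (∑ r, sgn r * A a r * A b r) * v a * v b = mSq w := by
    have : ∀ r, sgn r * w r * w r = ∑ a, ∑ b, sgn r * A a r * A b r * v a * v b := by
      intro r
      rw [mul_assoc, ← hww, Finset.mul_sum]
      simp only [Finset.mul_sum]
      exact Finset.sum_congr rfl fun a _ => Finset.sum_congr rfl fun b _ => by ring
    unfold mSq
    simp only [this, Finset.sum_mul]
    rw [Finset.sum_comm]
    conv_rhs => rw [Finset.sum_comm]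
    rw [Finset.sum_comm]
    refine Finset.sum_congr rfl fun a _ => ?_
    rw [Finset.sum_comm]
  have hl : ∀ l, ∑ a, ∑ b, SE2 A a b l m * v a * v b =
      2 * (w l * w m) - eta l m * mSq w := by
    intro l
    have hterm : ∀ a b, SE2 A a b l m * v a * v b =
        A a l * A b m * v a * v b + A a m * A b l * v a * v b
        - eta l m * ((∑ r, sgn r * A a r * A b r) * v a * v b)
        + ((1/2) * eta l m * (∑ r, ∑ s, sgn r * sgn s * A r s * A r s)
          - ∑ r, sgn r * A r l * A r m) * (eta a b * v a * v b) := by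
      intro a b
      unfold SE2
      ring
    simp only [hterm, Finset.sum_add_distrib, Finset.sum_sub_distrib, ← Finset.mul_sum, hww, hq,
      sum_eta_mul_mul, hv]
    ring
  have hcomm : ∑ a, ∑ b, ∑ l, SE2 A a b l m * v a * v b * v l =
      ∑ l, (∑ a, ∑ b, SE2 A a b l m * v a * v b) * v l := by
    simp only [Finset.sum_mul]
    rw [Finset.sum_comm (s := Finset.univ (α := Fin n)) (t := Finset.univ)
      (f := fun l a => ∑ b, SE2 A a b l m * v a * v b * v l)]
    exact Finset.sum_congr rfl fun a _ => Finset.sum_comm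
  rw [hcomm, ← sum_eta_mul]
  simp only [hl, Finset.mul_sum, Finset.sum_mul, ← Finset.sum_sub_distrib]
  exact Finset.sum_congr rfl fun l _ => by ring

/-- T_{αβλμ}ℓ^αℓ^βℓ^λ = 0 iff ℓ^μ A_{μ[ν}ℓ_{τ]} = 0, for null ℓ. -/
theorem stmt_14 {n : ℕ} (hn : 2 ≤ n) (A : Fin n → Fin n → ℝ)
    (ℓ : Fin n → ℝ) (hℓ0 : ℓ ≠ 0) (hnull : mSq ℓ = 0) :
    (∀ m : Fin n, ∑ a, ∑ b, ∑ l, SE2 A a b l m * ℓ a * ℓ b * ℓ l = 0) ↔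
      (∀ v t : Fin n,
        (∑ m, ℓ m * A m v) * lo ℓ t - (∑ m, ℓ m * A m t) * lo ℓ v = 0) := by
  obtain ⟨w, hw⟩ : ∃ w : Fin n → ℝ, ∀ i, w i = ∑ a, ℓ a * A a i := ⟨_, fun _ => rfl⟩
  simp only [sum_SE2_of_null A ℓ w hnull hw, ← hw]
  have hlo : ∀ i, sgn i * lo ℓ i = ℓ i := fun i => by
    unfold lo; linear_combination ℓ i * sgn_mul_self i
  have hlonull : mSq (lo ℓ) = 0 := by rw [mSq_lo, hnull]
  obtain ⟨k, hk⟩ := Function.ne_iff.mp hℓ0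
  have hk' : lo ℓ k ≠ 0 := fun h => hk (by simp [← hlo k, h])
  have hpair : ∑ i, sgn i * w i * lo ℓ i = ∑ i, w i * ℓ i :=
    Finset.sum_congr rfl fun i _ => by linear_combination w i * hlo i
  have hloself : ∑ i, lo ℓ i * ℓ i = 0 := hnull
  constructor
  · intro h
    have hp : ∑ i, w i * ℓ i = 0 := by
      have hsum : ∑ m, (2 * (∑ l, w l * ℓ l) * w m - mSq w * lo ℓ m) * ℓ m = 0 :=
        Finset.sum_eq_zero fun m _ => by rw [h m, zero_mul]
      simp only [sub_mul, Finset.sum_sub_distrib, mul_assoc, ← Finset.mul_sum, hloself] at hsum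
      have : (∑ i, w i * ℓ i) * (∑ i, w i * ℓ i) = 0 := by linarith
      exact mul_self_eq_zero.mp this
    have hq : mSq w = 0 := by
      have := h k
      rw [hp] at this
      have : mSq w * lo ℓ k = 0 := by linarith
      exact (mul_eq_zero.mp this).resolve_right hk'
    intro i j
    exact sub_eq_zero.mpr
      (mul_eq_mul_of_null_of_orthogonal w (lo ℓ) hq hlonull (hpair.trans hp) i j)
  · intro h m
    obtain ⟨c, hc⟩ : ∃ c : ℝ, ∀ i, w i = c * lo ℓ i :=
      ⟨w k / lo ℓ k, fun i => by field_simp; linear_combination h i k⟩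
    have hp : ∑ i, w i * ℓ i = 0 := by
      simp only [hc, mul_assoc, ← Finset.mul_sum, hloself, mul_zero]
    have hq : mSq w = 0 := by
      have : mSq w = c ^ 2 * mSq (lo ℓ) := by
        unfold mSq
        rw [Finset.mul_sum]
        exact Finset.sum_congr rfl fun i _ => by rw [hc]; ring
      rw [this, hlonull, mul_zero]
    rw [hp, hq]; ring
end
end
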